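/- Let $\mathbb{T}^n=\mathbb{R}^n/\mathbb{Z}^n$, let $B\subset\mathbb{R}^n$ be an open ball of positive radius centred at the origin, and for a function $f$ on $\mathbb{T}^n\times B\times\mathbb{R}$ write $f^t_p(q)=f(q,p,t)$. For $\sigma\ge 1$ let $\mathcal{B}_\sigma$ be the space of (real- or vector-valued) functions $f$ on $\mathbb{T}^n\times B\times\mathbb{R}$ such that $f$ is continuous, $\partial_p f$ exists and is continuous on $\mathbb{T}^n\times B\times\mathbb{R}$, and $f^t_p\in C^\sigma(\mathbb{T}^n)$ for all $(p,t)$. Let $|\cdot|_{C^\sigma}$ be the Hölder norm on $\mathbb{T}^n$ (the $C^\sigma$ norm when $\sigma$ is an integer). For $\sigma = 0$ or $\sigma\ge 1$, and for $l\ge 1$, put $$|f|_{\sigma,l}=\sup_{(p,t)\in B\times\mathbb{R}}|f^t_p|_{C^\sigma}(1+|t|^l)+\sup_{(p,t)\in B\times\mathbb{R}}|(\partial_pf)^t_p|_{C^0}(1+|t|^{l-1}),$$ $$|f|_{\sigma,0}=\sup_{(p,t)\in B\times\mathbb{R}}|f^t_p|_{C^\sigma}+\sup_{(p,t)\in B\times\mathbb{R}}|(\partial_pf)^t_p|_{C^0},$$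 with values in $[0,\infty]$ (and $0\cdot\infty=0$). Let $\sigma\ge1$, and let each of $l$ and $m$ be either $0$ or a real number $\ge1$. Let $f\in\mathcal{B}_\sigma$ be real-valued, let $g\in\mathcal{B}_\sigma$ be $\mathbb{R}^n$-valued, and let $\tilde g(q,p,t)=(g(q,p,t),p,t)$, where $g(q,p,t)$ is read modulo $\mathbb{Z}^n$, so that $\tilde g$ maps $\mathbb{T}^n\times B\times\mathbb{R}$ into itself. Then $f\circ\tilde g$ is continuous, $\partial_p(f\circ\tilde g)$ exists everywhere, $(f\circ\tilde g)^t_p\in C^\sigma(\mathbb{T}^n)$ for all $(p,t)$, and $$|f\circ\tilde g|_{\sigma,l+m}\le C(\sigma)\left(|f|_{\sigma,l}\,|g|_{1,m}^\sigma+|f|_{1,l}\,|g|_{\sigma,m}+|f|_{0,l+m}\right)$$ for a constant $C(\sigma)$ depending only on $n$ and $\sigma$. Moreover $f\circ\tilde g\in\mathcal{B}_\sigma$ (that is, $\partial_p(f\circ\tilde g)$ is also continuous) if $\sigma>1$ and $|f|_{\sigma,l}<\infty$, and, for every $\sigma\ge1$, if $\partial_qf$ is continuous on $\mathbb{T}^n\times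 B\times\mathbb{R}$. -/

import Mathlib

open scoped ENNReal NNReal Topology

noncomputable section

namespace Bias

/-- `ℝⁿ` with the Euclidean norm. Functions on the torus `𝕋ⁿ = ℝⁿ/ℤⁿ` are modelled as
`ℤⁿ`-periodic functions on `ℝⁿ`. -/
abbrev E (n : ℕ) := EuclideanSpace ℝ (Fin n)

/-- The lattice point of `ℤⁿ ⊂ ℝⁿ` with coordinates `k`. -/
def latt {n : ℕ} (k : Fin n → ℤ) : E n := WithLp.toLp 2 fun i => (k i : ℝ)

/-- The `C^k` norm of a function on `ℝⁿ`: the largest of the sup norms of its derivatives of order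
at most `k`. -/
def cNorm {n : ℕ} {F : Type*} [NormedAddCommGroup F] [NormedSpace ℝ F]
    (k : ℕ) (f : E n → F) : ℝ≥0∞ :=
  ⨆ i : Fin (k + 1), ⨆ x : E n, ‖iteratedFDeriv ℝ (i : ℕ) f x‖ₑ

/-- The Hölder norm `|f|_{C^σ}`: the `C^⌊σ⌋` norm plus, when `σ` is not an integer, the
`(σ - ⌊σ⌋)`-Hölder seminorm of the derivative of order `⌊σ⌋`. For periodic `f` the supremum over
pairs of points of `ℝⁿ` is the supremum over pairs of points of the torus, because the distance on
the torus is the least distance between representatives. -/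
def holderNorm {n : ℕ} {F : Type*} [NormedAddCommGroup F] [NormedSpace ℝ F]
    (σ : ℝ) (f : E n → F) : ℝ≥0∞ :=
  cNorm ⌊σ⌋₊ f +
    if (⌊σ⌋₊ : ℝ) = σ then 0 else
      ⨆ (x : E n) (y : E n) (_ : x ≠ y),
        ENNReal.ofReal (‖iteratedFDeriv ℝ ⌊σ⌋₊ f x - iteratedFDeriv ℝ ⌊σ⌋₊ f y‖ /
          ‖x - y‖ ^ (σ - (⌊σ⌋₊ : ℝ)))

/-- Membership in the Hölder class `C^σ`. -/
def IsHolder {n : ℕ} {F : Type*} [NormedAddCommGroup F] [NormedSpace ℝ F]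
    (σ : ℝ) (f : E n → F) : Prop :=
  ContDiff ℝ ⌊σ⌋₊ f ∧ holderNorm σ f < ⊤

/-- The time weight `1 + |t|^l`, replaced by `1` for `l = 0`. -/
def w1 (l t : ℝ) : ℝ := if l = 0 then 1 else 1 + |t| ^ l

/-- The time weight `1 + |t|^(l-1)`, replaced by `1` for `l = 0`. -/
def w2 (l t : ℝ) : ℝ := if l = 0 then 1 else 1 + |t| ^ (l - 1)

/-- The derivative `∂_p f`. -/
def pderiv {n : ℕ} {F : Type*} [NormedAddCommGroup F] [NormedSpace ℝ F]
    (f : E n → E n → ℝ → F) (q p : E n) (t : ℝ) : E n →L[ℝ] F :=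
  fderiv ℝ (fun p' => f q p' t) p

/-- The derivative `∂_q f`. -/
def qderiv {n : ℕ} {F : Type*} [NormedAddCommGroup F] [NormedSpace ℝ F]
    (f : E n → E n → ℝ → F) (q p : E n) (t : ℝ) : E n →L[ℝ] F :=
  fderiv ℝ (fun q' => f q' p t) q

/-- Joint continuity on `𝕋ⁿ × A × ℝ`. -/
def JointCont {n : ℕ} {F : Type*} [TopologicalSpace F]
    (A : Set (E n)) (f : E n → E n → ℝ → F) : Prop :=
  ContinuousOn (fun x : E n × E n × ℝ => f x.1 x.2.1 x.2.2)
    (Set.univ ×ˢ (A ×ˢ (Set.univ : Set ℝ)))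

/-- The requirements of the space `B_σ` other than the continuity of `∂_p f`: `f` is a continuous
function on `𝕋ⁿ × A × ℝ`, its derivative `∂_p f` exists everywhere (`A` is open), and each `f^t_p`
is of class `C^σ`. Nothing is required for `p` outside `A`. -/
structure PreB {n : ℕ} {F : Type*} [NormedAddCommGroup F] [NormedSpace ℝ F]
    (σ : ℝ) (A : Set (E n)) (f : E n → E n → ℝ → F) : Prop where
  periodic : ∀ (q : E n), ∀ p ∈ A, ∀ (t : ℝ) (k : Fin n → ℤ), f (q + latt k) p t = f q p t
  cont : JointCont A f
  diff : ∀ (q : E n), ∀ p ∈ A, ∀ t : ℝ, DifferentiableAt ℝ (fun p' => f q p' t) p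
  holder : ∀ p ∈ A, ∀ t : ℝ, IsHolder σ fun q => f q p t

/-- The space `B_σ` of functions on `𝕋ⁿ × A × ℝ`, for an open set `A`. -/
structure MemB {n : ℕ} {F : Type*} [NormedAddCommGroup F] [NormedSpace ℝ F]
    (σ : ℝ) (A : Set (E n)) (f : E n → E n → ℝ → F) : Prop extends PreB σ A f where
  cont_pderiv : JointCont A (pderiv f)

/-- The weighted norm `|f|_{σ,l}`. -/
def wnormB {n : ℕ} {F : Type*} [NormedAddCommGroup F] [NormedSpace ℝ F]
    (σ l : ℝ) (A : Set (E n)) (f : E n → E n → ℝ → F) : ℝ≥0∞ :=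
  (⨆ p ∈ A, ⨆ t : ℝ, holderNorm σ (fun q => f q p t) * ENNReal.ofReal (w1 l t)) +
    ⨆ p ∈ A, ⨆ t : ℝ, (⨆ q : E n, ‖pderiv f q p t‖ₑ) * ENNReal.ofReal (w2 l t)

/-- The composition `f ∘ g̃` with `g̃(q,p,t) = (g(q,p,t), p, t)`. -/
def compB {n : ℕ} {F : Type*} (f : E n → E n → ℝ → F) (g : E n → E n → ℝ → E n) :
    E n → E n → ℝ → F :=
  fun q p t => f (g q p t) p t

end Bias

end

namespace Bias

/-- A bounded Lipschitz function is Hölder. -/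
theorem norm_sub_le_rpow_of_bounded_of_lipschitz {V F : Type*} [SeminormedAddCommGroup V]
    [SeminormedAddCommGroup F] {u : V → F} {α M : ℝ} (hα : 0 < α) (hα1 : α ≤ 1)
    (h0 : ∀ x, ‖u x‖ ≤ M) (h1 : ∀ x y, ‖u x - u y‖ ≤ M * ‖x - y‖) (x y : V) :
    ‖u x - u y‖ ≤ 2 * M * ‖x - y‖ ^ α := by
  have hM : 0 ≤ M := (norm_nonneg _).trans (h0 x)
  rcases le_total ‖x - y‖ 1 with h | h
  · refine (h1 x y).trans ?_
    have h2 : ‖x - y‖ ≤ ‖x - y‖ ^ α := by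
      simpa using Real.rpow_le_rpow_of_exponent_ge_of_imp (norm_nonneg (x - y)) h hα1
        (fun _ hh => absurd hh one_ne_zero)
    nlinarith [mul_le_mul_of_nonneg_left h2 hM, mul_nonneg hM (norm_nonneg (x - y))]
  · have h2 : 1 ≤ ‖x - y‖ ^ α := Real.one_le_rpow h hα.le
    have h3 := norm_sub_le (u x) (u y)
    nlinarith [h0 x, h0 y]

section HolderBall

variable {V : Type} [NormedAddCommGroup V] [NormedSpace ℝ V]
  {F : Type} [NormedAddCommGroup F] [NormedSpace ℝ F]

/-- `u` is of class `C^k`, its derivatives of order at most `k` are bounded by `M`, and `M` is an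
`α`-Hölder constant of its derivative of order `k`. -/
structure HolderBall (k : ℕ) (α M : ℝ) (u : V → F) : Prop where
  contDiff : ContDiff ℝ k u
  bound : ∀ j ≤ k, ∀ x, ‖iteratedFDeriv ℝ j u x‖ ≤ M
  holder : ∀ x y, ‖iteratedFDeriv ℝ k u x - iteratedFDeriv ℝ k u y‖ ≤ M * ‖x - y‖ ^ α

theorem norm_iteratedFDeriv_succ_sub (k : ℕ) (u : V → F) (x y : V) :
    ‖iteratedFDeriv ℝ (k + 1) u x - iteratedFDeriv ℝ (k + 1) u y‖ =
      ‖iteratedFDeriv ℝ k (fderiv ℝ u) x - iteratedFDeriv ℝ k (fderiv ℝ u) y‖ := by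
  simp only [← dist_eq_norm, iteratedFDeriv_succ_eq_comp_right, Function.comp_apply]
  exact LinearIsometryEquiv.dist_map _ _ _

theorem norm_fderiv_iteratedFDeriv_sub (k : ℕ) (u : V → F) (x y : V) :
    ‖fderiv ℝ (iteratedFDeriv ℝ k u) x - fderiv ℝ (iteratedFDeriv ℝ k u) y‖ =
      ‖iteratedFDeriv ℝ (k + 1) u x - iteratedFDeriv ℝ (k + 1) u y‖ := by
  have e : fderiv ℝ (iteratedFDeriv ℝ k u) x - fderiv ℝ (iteratedFDeriv ℝ k u) y =
      continuousMultilinearCurryLeftEquiv ℝ (fun _ : Fin (k + 1) => V) F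
        (iteratedFDeriv ℝ (k + 1) u x - iteratedFDeriv ℝ (k + 1) u y) := by
    rw [fderiv_iteratedFDeriv]
    rfl
  rw [e]
  exact LinearIsometryEquiv.norm_map _ _

theorem norm_iteratedFDeriv_zero_sub (u : V → F) (x y : V) :
    ‖iteratedFDeriv ℝ 0 u x - iteratedFDeriv ℝ 0 u y‖ = ‖u x - u y‖ := by
  rw [iteratedFDeriv_zero_eq_comp, Function.comp_apply, Function.comp_apply, ← map_sub,
    LinearIsometryEquiv.norm_map]

namespace HolderBall

variable {k : ℕ} {α M N : ℝ} {u v : V → F}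

theorem nonneg (h : HolderBall k α M u) : 0 ≤ M :=
  (norm_nonneg _).trans (h.bound 0 (Nat.zero_le _) 0)

theorem norm_le (h : HolderBall k α M u) (x : V) : ‖u x‖ ≤ M := by
  simpa using h.bound 0 (Nat.zero_le _) x

theorem mono (h : HolderBall k α M u) (hMN : M ≤ N) : HolderBall k α N u where
  contDiff := h.contDiff
  bound j hj x := (h.bound j hj x).trans hMN
  holder x y := (h.holder x y).trans (by gcongr)

theorem zero_iff : HolderBall 0 α M u ↔
    Continuous u ∧ (∀ x, ‖u x‖ ≤ M) ∧ ∀ x y, ‖u x - u y‖ ≤ M * ‖x - y‖ ^ α := by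
  constructor
  · intro h
    refine ⟨h.contDiff.continuous, h.norm_le, fun x y => ?_⟩
    rw [← norm_iteratedFDeriv_zero_sub]
    exact h.holder x y
  · rintro ⟨h0, h1, h2⟩
    refine ⟨by simpa [contDiff_zero] using h0, fun j hj x => ?_, fun x y => ?_⟩
    · obtain rfl : j = 0 := by omega
      simpa using h1 x
    · rw [norm_iteratedFDeriv_zero_sub]
      exact h2 x y

theorem succ_iff : HolderBall (k + 1) α M u ↔
    Differentiable ℝ u ∧ (∀ x, ‖u x‖ ≤ M) ∧ HolderBall k α M (fderiv ℝ u) := by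
  constructor
  · intro h
    refine ⟨h.contDiff.differentiable (by simp), h.norm_le, ?_, fun j hj x => ?_, fun x y => ?_⟩
    · exact h.contDiff.fderiv_right (by simp)
    · rw [norm_iteratedFDeriv_fderiv]
      exact h.bound _ (by omega) x
    · rw [← norm_iteratedFDeriv_succ_sub]
      exact h.holder x y
  · rintro ⟨h0, h1, h2⟩
    refine ⟨?_, fun j hj x => ?_, fun x y => ?_⟩
    · push_cast
      exact contDiff_succ_iff_fderiv.2 ⟨h0, by simp, h2.contDiff⟩
    · cases j with
      | zero => simpa using h1 x
      | succ j =>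
        rw [← norm_iteratedFDeriv_fderiv]
        exact h2.bound j (by omega) x
    · rw [norm_iteratedFDeriv_succ_sub]
      exact h2.holder x y

theorem congr_bound (h : HolderBall k α M u) (hMN : M = N) : HolderBall k α N u := hMN ▸ h

theorem of_succ (hα : 0 < α) (hα1 : α ≤ 1) :
    ∀ {k : ℕ} {F : Type} [NormedAddCommGroup F] [NormedSpace ℝ F] {u : V → F},
      HolderBall (k + 1) α M u → HolderBall k α (2 * M) u := by
  intro k
  induction k with
  | zero =>
    intro F _ _ u h
    obtain ⟨h0, h1, h2⟩ := succ_iff.1 h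
    have hM := h.nonneg
    refine zero_iff.2 ⟨h0.continuous, fun x => (h1 x).trans (by linarith),
      norm_sub_le_rpow_of_bounded_of_lipschitz hα hα1 h1 fun x y => ?_⟩
    exact convex_univ.norm_image_sub_le_of_norm_fderiv_le (fun z _ => h0 z)
      (fun z _ => h2.norm_le z) (Set.mem_univ y) (Set.mem_univ x)
  | succ k ih =>
    intro F _ _ u h
    obtain ⟨h0, h1, h2⟩ := succ_iff.1 h
    have hM := h.nonneg
    exact succ_iff.2 ⟨h0, fun x => (h1 x).trans (by linarith), ih h2⟩

theorem add (hu : HolderBall k α M u) (hv : HolderBall k α N v) :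
    HolderBall k α (M + N) (fun x => u x + v x) := by
  have key : ∀ j ≤ k, ∀ x, iteratedFDeriv ℝ j (fun x => u x + v x) x =
      iteratedFDeriv ℝ j u x + iteratedFDeriv ℝ j v x := fun j hj x =>
    iteratedFDeriv_add_apply ((hu.contDiff.of_le (by exact_mod_cast hj)).contDiffAt)
      ((hv.contDiff.of_le (by exact_mod_cast hj)).contDiffAt)
  refine ⟨hu.contDiff.add hv.contDiff, fun j hj x => ?_, fun x y => ?_⟩
  · rw [key j hj]
    exact (norm_add_le _ _).trans (add_le_add (hu.bound j hj x) (hv.bound j hj x))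
  · rw [key k le_rfl, key k le_rfl, add_sub_add_comm, add_mul]
    exact (norm_add_le _ _).trans (add_le_add (hu.holder x y) (hv.holder x y))

theorem bilinear : ∀ {k : ℕ} {F₁ F₂ F₃ : Type} [NormedAddCommGroup F₁] [NormedSpace ℝ F₁]
    [NormedAddCommGroup F₂] [NormedSpace ℝ F₂] [NormedAddCommGroup F₃] [NormedSpace ℝ F₃]
    {M N α : ℝ} (_ : 0 < α) (_ : α ≤ 1) (B : F₁ →L[ℝ] F₂ →L[ℝ] F₃) (_ : ‖B‖ ≤ 1)
    {u : V → F₁} {v : V → F₂}, HolderBall k α M u → HolderBall k α N v →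
      HolderBall k α (4 ^ (k + 1) * (M * N)) (fun x => B (u x) (v x)) := by
  have le_mul : ∀ {F₁ F₂ F₃ : Type} [NormedAddCommGroup F₁] [NormedSpace ℝ F₁]
      [NormedAddCommGroup F₂] [NormedSpace ℝ F₂] [NormedAddCommGroup F₃] [NormedSpace ℝ F₃]
      (B : F₁ →L[ℝ] F₂ →L[ℝ] F₃) (_ : ‖B‖ ≤ 1) (a : F₁) (b : F₂), ‖B a b‖ ≤ ‖a‖ * ‖b‖ := by
    intro F₁ F₂ F₃ _ _ _ _ _ _ B hB a b
    refine (B.le_opNorm₂ a b).trans ?_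
    rw [mul_assoc]
    exact mul_le_of_le_one_left (by positivity) hB
  intro k
  induction k with
  | zero =>
    intro F₁ F₂ F₃ _ _ _ _ _ _ M N α _ _ B hB u v hu hv
    have hM := hu.nonneg
    have hN := hv.nonneg
    have hMN := mul_nonneg hM hN
    obtain ⟨u0, u1, u2⟩ := zero_iff.1 hu
    obtain ⟨v0, v1, v2⟩ := zero_iff.1 hv
    refine zero_iff.2 ⟨by fun_prop, fun x => ?_, fun x y => ?_⟩
    · have := (le_mul B hB (u x) (v x)).trans (mul_le_mul (u1 x) (v1 x) (norm_nonneg _) hM)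
      rw [zero_add, pow_one]
      linarith
    · have e : B (u x) (v x) - B (u y) (v y) = B (u x - u y) (v x) + B (u y) (v x - v y) := by
        simp
      have h1 := (le_mul B hB (u x - u y) (v x)).trans
        (mul_le_mul (u2 x y) (v1 x) (norm_nonneg _) (by positivity))
      have h2 := (le_mul B hB (u y) (v x - v y)).trans
        (mul_le_mul (u1 y) (v2 x y) (norm_nonneg _) hM)
      rw [e]
      refine (norm_add_le _ _).trans ((add_le_add h1 h2).trans ?_)
      have : 0 ≤ M * N * ‖x - y‖ ^ α := by positivity
      rw [zero_add, pow_one]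
      nlinarith
  | succ k ih =>
    intro F₁ F₂ F₃ _ _ _ _ _ _ M N α hα hα1 B hB u v hu hv
    have hM := hu.nonneg
    have hN := hv.nonneg
    have hMN := mul_nonneg hM hN
    obtain ⟨u0, u1, u2⟩ := succ_iff.1 hu
    obtain ⟨v0, v1, v2⟩ := succ_iff.1 hv
    have hd : ∀ x, HasFDerivAt (fun x => B (u x) (v x))
        (B.precompR V (u x) (fderiv ℝ v x) + B.precompL V (fderiv ℝ u x) (v x)) x := fun x =>
      B.hasFDerivAt_of_bilinear (u0 x).hasFDerivAt (v0 x).hasFDerivAt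
    refine succ_iff.2 ⟨fun x => (hd x).differentiableAt, fun x => ?_, ?_⟩
    · have := (le_mul B hB (u x) (v x)).trans (mul_le_mul (u1 x) (v1 x) (norm_nonneg _) hM)
      exact this.trans (le_mul_of_one_le_left hMN (one_le_pow₀ (by norm_num)))
    · have e : fderiv ℝ (fun x => B (u x) (v x)) = fun x =>
          B.precompR V (u x) (fderiv ℝ v x) + B.precompL V (fderiv ℝ u x) (v x) :=
        funext fun x => (hd x).fderiv
      rw [e]
      have h1 := ih hα hα1 (B.precompR V) ((B.norm_precompR_le V).trans hB) (hu.of_succ hα hα1) v2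
      have h2 := ih hα hα1 (B.precompL V) ((B.norm_precompL_le V).trans hB) u2 (hv.of_succ hα hα1)
      refine (h1.add h2).congr_bound ?_
      ring

/-- Composition of Hölder functions, with a bound that is not optimal. -/
theorem comp {W : Type} [NormedAddCommGroup W] [NormedSpace ℝ W] {α : ℝ} (hα : 0 < α)
    (hα1 : α ≤ 1) : ∀ (k : ℕ) (R : ℝ), 1 ≤ R → ∃ C : ℝ, 1 ≤ C ∧
    ∀ {F : Type} [NormedAddCommGroup F] [NormedSpace ℝ F] {M : ℝ} {f : W → F} {g : V → W},
      HolderBall k α M f → Differentiable ℝ g → HolderBall k α R (fderiv ℝ g) →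
      HolderBall k α (C * M) (f ∘ g) := by
  intro k
  induction k with
  | zero =>
    intro R hR
    refine ⟨R, hR, fun {F} _ _ {M f g} hf hg hg' => ?_⟩
    have hM := hf.nonneg
    obtain ⟨f0, f1, f2⟩ := zero_iff.1 hf
    refine zero_iff.2 ⟨f0.comp hg.continuous, fun x => (f1 _).trans (by nlinarith), fun x y => ?_⟩
    have hl : ‖g x - g y‖ ≤ R * ‖x - y‖ :=
      convex_univ.norm_image_sub_le_of_norm_fderiv_le (fun z _ => hg z)
        (fun z _ => hg'.norm_le z) (Set.mem_univ y) (Set.mem_univ x)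
    have h1 : ‖g x - g y‖ ^ α ≤ R * ‖x - y‖ ^ α := by
      refine (Real.rpow_le_rpow (norm_nonneg _) hl hα.le).trans ?_
      rw [Real.mul_rpow (by linarith) (norm_nonneg _)]
      gcongr
      simpa using Real.rpow_le_rpow_of_exponent_le hR hα1
    refine (f2 (g x) (g y)).trans ((mul_le_mul_of_nonneg_left h1 hM).trans (le_of_eq ?_))
    ring
  | succ k ih =>
    intro R hR
    obtain ⟨C, hC1, hC⟩ := ih (2 * R) (by linarith)
    have hp : (1 : ℝ) ≤ 4 ^ (k + 1) := one_le_pow₀ (by norm_num)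
    have hC' : 1 ≤ 4 ^ (k + 1) * (C * (2 * R)) := by
      refine one_le_mul_of_one_le_of_one_le hp (one_le_mul_of_one_le_of_one_le hC1 (by linarith))
    refine ⟨_, hC', fun {F} _ _ {M f g} hf hg hg' => ?_⟩
    have hM := hf.nonneg
    obtain ⟨f0, f1, f2⟩ := succ_iff.1 hf
    have hg2 := hg'.of_succ hα hα1
    refine succ_iff.2 ⟨f0.comp hg, fun x => (f1 _).trans (le_mul_of_one_le_left hM hC'), ?_⟩
    have e : fderiv ℝ (f ∘ g) = fun x =>
        ContinuousLinearMap.compL ℝ V W F ((fderiv ℝ f ∘ g) x) (fderiv ℝ g x) :=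
      funext fun x => fderiv_comp x (f0 _) (hg x)
    rw [e]
    refine (bilinear hα hα1 _ (ContinuousLinearMap.norm_compL_le ℝ V W F) (hC f2 hg hg2)
      hg2).congr_bound ?_
    ring

end HolderBall

end HolderBall

end Bias

namespace Bias

section Interpolation

variable {V : Type} [NormedAddCommGroup V] [NormedSpace ℝ V]
  {F : Type} [NormedAddCommGroup F] [NormedSpace ℝ F]

/-- First order Taylor estimate for a function whose derivative is Hölder. -/
theorem norm_sub_sub_fderiv_le {u : V → F} {α H : ℝ} (hu : Differentiable ℝ u) (hα : 0 ≤ α)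
    (hH0 : 0 ≤ H) (hH : ∀ x y, ‖fderiv ℝ u x - fderiv ℝ u y‖ ≤ H * ‖x - y‖ ^ α) (x w : V) :
    ‖u (x + w) - u x - fderiv ℝ u x w‖ ≤ H * ‖w‖ ^ α * ‖w‖ := by
  have h := (convex_closedBall x ‖w‖).norm_image_sub_le_of_norm_fderiv_le' (𝕜 := ℝ) (f := u)
    (φ := fderiv ℝ u x) (C := H * ‖w‖ ^ α) (x := x) (y := x + w) (fun z _ => hu z)
    (fun z hz => (hH z x).trans ?_) (by simp) (by simp)
  · simpa using h
  · rw [mem_closedBall_iff_norm] at hz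
    gcongr

theorem norm_fderiv_le_of_holder {u : V → F} {α H a h : ℝ} (hu : Differentiable ℝ u)
    (hα : 0 ≤ α) (hH0 : 0 ≤ H) (ha : ∀ x, ‖u x‖ ≤ a)
    (hH : ∀ x y, ‖fderiv ℝ u x - fderiv ℝ u y‖ ≤ H * ‖x - y‖ ^ α) (hh : 0 < h) (x : V) :
    ‖fderiv ℝ u x‖ ≤ 2 * a / h + H * h ^ α := by
  have ha0 : 0 ≤ a := (norm_nonneg _).trans (ha x)
  refine ContinuousLinearMap.opNorm_le_of_unit_norm (by positivity) fun v hv => ?_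
  have h1 := norm_sub_sub_fderiv_le hu hα hH0 hH x (h • v)
  have hn : ‖h • v‖ = h := by rw [norm_smul, hv, mul_one, Real.norm_of_nonneg hh.le]
  rw [hn, map_smul] at h1
  have h2 : ‖h • fderiv ℝ u x v‖ ≤ 2 * a + H * h ^ α * h := by
    have e : h • fderiv ℝ u x v =
        (u (x + h • v) - u x) - (u (x + h • v) - u x - h • fderiv ℝ u x v) := by abel
    rw [e]
    refine (norm_sub_le _ _).trans (add_le_add ((norm_sub_le _ _).trans ?_) h1)
    linarith [ha x, ha (x + h • v)]
  rw [norm_smul, Real.norm_of_nonneg hh.le] at h2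
  have e2 : 2 * a / h + H * h ^ α = (2 * a + H * h ^ α * h) / h := by field_simp
  rw [e2, le_div_iff₀ hh]
  linarith

theorem exists_le_mul_succ_add_mul_zero (j : ℕ) : ∀ ε : ℝ, 0 < ε → ∃ C : ℝ, 0 ≤ C ∧
    ∀ S : ℕ → ℝ, (∀ i, 0 ≤ S i) →
      (∀ i < j, ∀ h : ℝ, 0 < h → S (i + 1) ≤ 2 * S i / h + S (i + 2) * h) →
      S j ≤ ε * S (j + 1) + C * S 0 := by
  induction j with
  | zero =>
    intro ε hε
    refine ⟨1, zero_le_one, fun S hS _ => ?_⟩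
    have := mul_nonneg hε.le (hS 1)
    rw [zero_add]
    linarith
  | succ j ih =>
    intro ε hε
    obtain ⟨C, hC0, hC⟩ := ih (ε / 8) (by linarith)
    refine ⟨8 * C / ε, by positivity, fun S hS hS2 => ?_⟩
    have h1 := hC S hS fun i hi => hS2 i (by omega)
    have h2 := hS2 j (by omega) (ε / 2) (by linarith)
    have h3 : 2 * S j / (ε / 2) ≤ S (j + 1) / 2 + 4 * C / ε * S 0 := by
      rw [div_le_iff₀ (by linarith)]
      have : (S (j + 1) / 2 + 4 * C / ε * S 0) * (ε / 2) = ε / 4 * S (j + 1) + 2 * C * S 0 := by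
        field_simp
        ring
      rw [this]
      linarith
    have h4 : 8 * C / ε * S 0 = 2 * (4 * C / ε * S 0) := by ring
    rw [h4]
    have : S (j + 1 + 1) = S (j + 2) := rfl
    rw [this]
    linarith

/-- Interpolation: a bound on `u` and on the Hölder constant of its derivative of order `k` bounds
all intermediate derivatives. -/
theorem exists_holderBall_of_norm_le_of_holder {α : ℝ} (hα : 0 < α) (k : ℕ) : ∃ C : ℝ, 1 ≤ C ∧
    ∀ {F : Type} [NormedAddCommGroup F] [NormedSpace ℝ F] {u : V → F} {a K : ℝ},
      HolderBall k α K u → (∀ x, ‖u x‖ ≤ a) →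
      (∀ x y, ‖iteratedFDeriv ℝ k u x - iteratedFDeriv ℝ k u y‖ ≤ a * ‖x - y‖ ^ α) →
      HolderBall k α (C * a) u := by
  cases k with
  | zero =>
    refine ⟨1, le_rfl, fun {F} _ _ {u a K} hu h0 h1 => ?_⟩
    rw [one_mul]
    refine ⟨hu.contDiff, fun j hj x => ?_, h1⟩
    obtain rfl : j = 0 := by omega
    simpa using h0 x
  | succ k =>
    obtain ⟨B, hB0, hB⟩ := exists_le_mul_succ_add_mul_zero k (1 / 4) (by norm_num)
    choose c hc0 hc using fun j => exists_le_mul_succ_add_mul_zero j 1 one_pos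
    have hs : ∀ s : Finset ℕ, 0 ≤ ∑ i ∈ s, c i := fun s => Finset.sum_nonneg fun i _ => hc0 i
    refine ⟨2 + 4 * B + ∑ i ∈ Finset.range (k + 1), c i, by linarith [hs (Finset.range (k + 1))],
      fun {F} _ _ {u a K} hu h0 h1 => ?_⟩
    have ha : 0 ≤ a := (norm_nonneg _).trans (h0 0)
    set S : ℕ → ℝ := fun j => ⨆ x, ‖iteratedFDeriv ℝ j u x‖ with hSdef
    have hbdd : ∀ j ≤ k + 1, BddAbove (Set.range fun x => ‖iteratedFDeriv ℝ j u x‖) :=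
      fun j hj => ⟨K, by rintro _ ⟨x, rfl⟩; exact hu.bound j hj x⟩
    have hle : ∀ j ≤ k + 1, ∀ x, ‖iteratedFDeriv ℝ j u x‖ ≤ S j :=
      fun j hj x => le_ciSup (hbdd j hj) x
    have hS0 : ∀ j, 0 ≤ S j := fun j => Real.iSup_nonneg fun x => norm_nonneg _
    have hSa : S 0 ≤ a := ciSup_le fun x => by simpa using h0 x
    have hdiff : ∀ j < k + 1, Differentiable ℝ (iteratedFDeriv ℝ j u) := fun j hj =>
      hu.contDiff.differentiable_iteratedFDeriv (by exact_mod_cast hj)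
    have hconv : ∀ i < k, ∀ h : ℝ, 0 < h → S (i + 1) ≤ 2 * S i / h + S (i + 2) * h := by
      intro i hi h hh
      refine ciSup_le fun x => ?_
      rw [← norm_fderiv_iteratedFDeriv]
      have := norm_fderiv_le_of_holder (α := 1) (H := S (i + 2)) (hdiff i (by omega)) zero_le_one
        (hS0 _) (hle i (by omega)) (fun x y => ?_) hh x
      · simpa using this
      · rw [norm_fderiv_iteratedFDeriv_sub, Real.rpow_one]
        exact convex_univ.norm_image_sub_le_of_norm_fderiv_le
          (fun z _ => hdiff (i + 1) (by omega) z)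
          (fun z _ => by rw [norm_fderiv_iteratedFDeriv]; exact hle (i + 2) (by omega) z)
          (Set.mem_univ y) (Set.mem_univ x)
    have htop : S (k + 1) ≤ 2 * S k + a := by
      refine ciSup_le fun x => ?_
      rw [← norm_fderiv_iteratedFDeriv]
      have := norm_fderiv_le_of_holder (α := α) (H := a) (hdiff k (by omega)) hα.le ha
        (hle k (by omega)) (fun x y => by rw [norm_fderiv_iteratedFDeriv_sub]; exact h1 x y)
        one_pos x
      simpa using this
    have hk := hB S hS0 hconv
    have hBS := mul_le_mul_of_nonneg_left hSa hB0
    have htop' : S (k + 1) ≤ (2 + 4 * B) * a := by linarith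
    have hdown : ∀ d ≤ k + 1, S (k + 1 - d) ≤
        S (k + 1) + (∑ i ∈ Finset.Ico (k + 1 - d) (k + 1), c i) * a := by
      intro d
      induction d with
      | zero => simp
      | succ d ih =>
        intro hd
        have e : k + 1 - d = (k + 1 - (d + 1)) + 1 := by omega
        have h2 := ih (by omega)
        have h3 := hc (k + 1 - (d + 1)) S hS0 fun i hi => hconv i (by omega)
        rw [e] at h2
        rw [Finset.sum_eq_sum_Ico_succ_bot (by omega), add_mul]
        have h4 := mul_le_mul_of_nonneg_left hSa (hc0 (k + 1 - (d + 1)))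
        linarith
    have hall : ∀ j ≤ k + 1, S j ≤ (2 + 4 * B + ∑ i ∈ Finset.range (k + 1), c i) * a := by
      intro j hj
      have h2 := hdown (k + 1 - j) (by omega)
      rw [show k + 1 - (k + 1 - j) = j by omega] at h2
      have h3 : ∑ i ∈ Finset.Ico j (k + 1), c i ≤ ∑ i ∈ Finset.range (k + 1), c i :=
        Finset.sum_le_sum_of_subset_of_nonneg (fun i hi => by simp at hi ⊢; omega)
          fun i _ _ => hc0 i
      have h4 := mul_le_mul_of_nonneg_right h3 ha
      rw [add_mul]
      linarith
    refine ⟨hu.contDiff, fun j hj x => (hle j hj x).trans (hall j hj), fun x y =>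
      (h1 x y).trans ?_⟩
    gcongr
    exact le_mul_of_one_le_left ha (by linarith [hs (Finset.range (k + 1))])

end Interpolation

section Composition

variable {V W : Type} [NormedAddCommGroup V] [NormedSpace ℝ V]
  [NormedAddCommGroup W] [NormedSpace ℝ W]
  {F : Type} [NormedAddCommGroup F] [NormedSpace ℝ F]

theorem HolderBall.exists_fderiv_comp {α : ℝ} (hα : 0 < α) (hα1 : α ≤ 1) (k : ℕ) (R : ℝ)
    (hR : 1 ≤ R) : ∃ C : ℝ, 1 ≤ C ∧
    ∀ {M : ℝ} {f : W → F} {g : V → W}, Differentiable ℝ f → Differentiable ℝ g →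
      HolderBall k α M (fderiv ℝ f) → HolderBall k α R (fderiv ℝ g) →
      HolderBall k α (C * M) (fderiv ℝ (f ∘ g)) := by
  obtain ⟨C, hC1, hC⟩ := HolderBall.comp (V := V) (W := W) hα hα1 k R hR
  have hp : (1 : ℝ) ≤ 4 ^ (k + 1) := one_le_pow₀ (by norm_num)
  refine ⟨4 ^ (k + 1) * (C * R), one_le_mul_of_one_le_of_one_le hp
    (one_le_mul_of_one_le_of_one_le hC1 hR), fun {M f g} f0 hg hf' hg' => ?_⟩
  have e : fderiv ℝ (f ∘ g) = fun x =>
      ContinuousLinearMap.compL ℝ V W F ((fderiv ℝ f ∘ g) x) (fderiv ℝ g x) :=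
    funext fun x => fderiv_comp x (f0 _) (hg x)
  rw [e]
  refine (HolderBall.bilinear hα hα1 _ (ContinuousLinearMap.norm_compL_le ℝ V W F)
    (hC hf' hg hg') hg').congr_bound ?_
  ring

theorem HolderBall.exists_comp {α : ℝ} (hα : 0 < α) (hα1 : α ≤ 1) {k : ℕ} {K L : ℝ} {f : W → F}
    {g : V → W} (hf : HolderBall (k + 1) α K f) (hg : HolderBall (k + 1) α L g) :
    ∃ M, HolderBall (k + 1) α M (f ∘ g) := by
  obtain ⟨f0, f1, f2⟩ := HolderBall.succ_iff.1 hf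
  obtain ⟨g0, g1, g2⟩ := HolderBall.succ_iff.1 hg
  obtain ⟨C, hC1, hC⟩ := HolderBall.exists_fderiv_comp (V := V) (W := W) (F := F) hα hα1 k
    (max L 1) (le_max_right _ _)
  exact ⟨C * K, HolderBall.succ_iff.2 ⟨f0.comp g0, fun x => (f1 _).trans
    (le_mul_of_one_le_left hf.nonneg hC1), hC f0 g0 f2 (g2.mono (le_max_left _ _))⟩⟩

theorem iteratedFDeriv_const_smul_comp_const_smul {k : ℕ} {u : V → F} (hu : ContDiff ℝ k u)
    (a c : ℝ) (x : V) :
    iteratedFDeriv ℝ k (fun z => a • u (c • z)) x = (a * c ^ k) • iteratedFDeriv ℝ k u (c • x) := by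
  have h : ContDiff ℝ k fun z => u (c • z) := hu.comp (contDiff_const_smul c)
  rw [iteratedFDeriv_const_smul_apply' h.contDiffAt, iteratedFDeriv_comp_const_smul c hu, smul_smul]

theorem fderiv_const_smul_comp_const_smul (u : V → F) (a c : ℝ) (x : V) :
    fderiv ℝ (fun z => a • u (c • z)) x = (a * c) • fderiv ℝ u (c • x) := by
  rw [show (fun z => a • u (c • z)) = a • fun z => u (c • z) from rfl, fderiv_const_smul_field,
    Pi.smul_apply, fderiv_comp_smul, smul_smul]

theorem HolderBall.exists_const_smul_comp_const_smul {k : ℕ} {α K : ℝ} {u : V → F}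
    (hu : HolderBall k α K u) (a c : ℝ) :
    ∃ M, HolderBall k α M (fun z => a • u (c • z)) := by
  have hK := hu.nonneg
  refine ⟨∑ j ∈ Finset.range (k + 1), |a * c ^ j| * K + |a * c ^ k| * K * |c| ^ α,
    contDiff_const.smul (hu.contDiff.comp (contDiff_const_smul c)), fun j hj x => ?_,
    fun x y => ?_⟩
  · rw [iteratedFDeriv_const_smul_comp_const_smul
      (hu.contDiff.of_le (by exact_mod_cast hj)), norm_smul, Real.norm_eq_abs]
    have h1 : |a * c ^ j| * K ≤ ∑ j ∈ Finset.range (k + 1), |a * c ^ j| * K :=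
      Finset.single_le_sum (f := fun j => |a * c ^ j| * K) (fun i _ => by positivity)
        (by simp; omega)
    have h2 := mul_le_mul_of_nonneg_left (hu.bound j hj (c • x)) (abs_nonneg (a * c ^ j))
    have h3 : 0 ≤ |a * c ^ k| * K * |c| ^ α := by positivity
    linarith
  · rw [iteratedFDeriv_const_smul_comp_const_smul hu.contDiff,
      iteratedFDeriv_const_smul_comp_const_smul hu.contDiff, ← smul_sub, norm_smul,
      Real.norm_eq_abs]
    have h2 := mul_le_mul_of_nonneg_left (hu.holder (c • x) (c • y)) (abs_nonneg (a * c ^ k))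
    rw [← smul_sub, norm_smul, Real.norm_eq_abs,
      Real.mul_rpow (abs_nonneg _) (norm_nonneg _)] at h2
    have h3 : 0 ≤ ∑ j ∈ Finset.range (k + 1), |a * c ^ j| * K :=
      Finset.sum_nonneg fun i _ => by positivity
    have h4 := mul_nonneg h3 (Real.rpow_nonneg (norm_nonneg (x - y)) α)
    rw [add_mul]
    linarith

end Composition

end Bias

namespace Bias

section CompositionEstimate

variable {V W : Type} [NormedAddCommGroup V] [NormedSpace ℝ V]
  [NormedAddCommGroup W] [NormedSpace ℝ W]
  {F : Type} [NormedAddCommGroup F] [NormedSpace ℝ F]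

/-- The composition estimate for the Hölder constant of the top derivative, when the relevant
seminorms of both functions are at most `1`. -/
theorem exists_holder_comp_of_le_one {α : ℝ} (hα : 0 < α) (hα1 : α ≤ 1) (k : ℕ) :
    ∃ C : ℝ, 1 ≤ C ∧ ∀ {f : W → F} {g : V → W} {K L : ℝ},
      HolderBall (k + 1) α K f → HolderBall (k + 1) α L g →
      (∀ x, ‖fderiv ℝ f x‖ ≤ 1) → (∀ x, ‖fderiv ℝ g x‖ ≤ 1) →
      (∀ x y, ‖iteratedFDeriv ℝ (k + 1) f x - iteratedFDeriv ℝ (k + 1) f y‖ ≤ ‖x - y‖ ^ α) →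
      (∀ x y, ‖iteratedFDeriv ℝ (k + 1) g x - iteratedFDeriv ℝ (k + 1) g y‖ ≤ ‖x - y‖ ^ α) →
      ∀ x y, ‖iteratedFDeriv ℝ (k + 1) (f ∘ g) x - iteratedFDeriv ℝ (k + 1) (f ∘ g) y‖ ≤
        C * ‖x - y‖ ^ α := by
  obtain ⟨A, hA1, hA⟩ := exists_holderBall_of_norm_le_of_holder (V := W) hα k
  obtain ⟨B, hB1, hB⟩ := exists_holderBall_of_norm_le_of_holder (V := V) hα k
  obtain ⟨C, hC1, hC⟩ := HolderBall.exists_fderiv_comp (V := V) (W := W) (F := F) hα hα1 k B hB1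
  refine ⟨C * A, one_le_mul_of_one_le_of_one_le hC1 hA1,
    fun {f g K L} hf hg f1 g1 fh gh x y => ?_⟩
  obtain ⟨f0, -, f2⟩ := HolderBall.succ_iff.1 hf
  obtain ⟨g0, -, g2⟩ := HolderBall.succ_iff.1 hg
  have hf' : HolderBall k α A (fderiv ℝ f) := by
    simpa using hA f2 f1 fun x y => by simpa [← norm_iteratedFDeriv_succ_sub] using fh x y
  have hg' : HolderBall k α B (fderiv ℝ g) := by
    simpa using hB g2 g1 fun x y => by simpa [← norm_iteratedFDeriv_succ_sub] using gh x y
  rw [norm_iteratedFDeriv_succ_sub]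
  exact (hC f0 g0 hf' hg').holder x y

theorem exists_holder_comp_of_pos {α : ℝ} (hα : 0 < α) (hα1 : α ≤ 1) (k : ℕ) :
    ∃ C : ℝ, 1 ≤ C ∧ ∀ {f : W → F} {g : V → W} {K L F₁ Fs G₁ Gs : ℝ},
      HolderBall (k + 1) α K f → HolderBall (k + 1) α L g →
      0 < F₁ → 0 < Fs → 0 < G₁ → 0 < Gs →
      (∀ x, ‖fderiv ℝ f x‖ ≤ F₁) → (∀ x, ‖fderiv ℝ g x‖ ≤ G₁) →
      (∀ x y, ‖iteratedFDeriv ℝ (k + 1) f x - iteratedFDeriv ℝ (k + 1) f y‖ ≤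
        Fs * ‖x - y‖ ^ α) →
      (∀ x y, ‖iteratedFDeriv ℝ (k + 1) g x - iteratedFDeriv ℝ (k + 1) g y‖ ≤
        Gs * ‖x - y‖ ^ α) →
      ∀ x y, ‖iteratedFDeriv ℝ (k + 1) (f ∘ g) x - iteratedFDeriv ℝ (k + 1) (f ∘ g) y‖ ≤
        C * (Fs * G₁ ^ (k + 1 + α) + F₁ * Gs) * ‖x - y‖ ^ α := by
  obtain ⟨C, hC1, hC⟩ := exists_holder_comp_of_le_one (V := V) (W := W) (F := F) hα hα1 k
  refine ⟨C, hC1, fun {f g K L F₁ Fs G₁ Gs} hf hg hF1 hFs hG1 hGs f1 g1 fh gh x y => ?_⟩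
  have hs : 0 < k + α := by positivity
  set S : ℝ := G₁ ^ (k + α) * Fs / F₁ + Gs / G₁ with hS
  have hS0 : 0 < S := by positivity
  set μ : ℝ := S⁻¹ ^ (k + α)⁻¹ with hμ
  have hμ0 : 0 < μ := by positivity
  have hμS : μ ^ (k + α) = S⁻¹ := by
    rw [hμ, ← Real.rpow_mul (by positivity), inv_mul_cancel₀ hs.ne', Real.rpow_one]
  set c : ℝ := μ * G₁ with hc
  have hc0 : 0 < c := by positivity
  set a : ℝ := (c * F₁)⁻¹ with ha
  have ha0 : 0 < a := by positivity
  have hpow : ∀ z : ℝ, 0 < z → z ^ (k + 1) * z ^ α = z * z ^ (k + α) := by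
    intro z hz
    rw [← Real.rpow_natCast, ← Real.rpow_add hz]
    nth_rw 2 [← Real.rpow_one z]
    rw [← Real.rpow_add hz]
    push_cast
    congr 1
    ring
  have hscale : ∀ {U : Type} [NormedAddCommGroup U] [NormedSpace ℝ U] (s : ℝ) (x y : U),
      0 < s → ‖s • x - s • y‖ ^ α = s ^ α * ‖x - y‖ ^ α := by
    intro U _ _ s x y hs
    rw [← smul_sub, norm_smul, Real.norm_of_nonneg hs.le, Real.mul_rpow hs.le (norm_nonneg _)]
  have hSg : S⁻¹ * (Gs / G₁) ≤ 1 := by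
    rw [inv_mul_le_iff₀ hS0, mul_one, hS]
    exact le_add_of_nonneg_left (by positivity)
  have hSf : S⁻¹ * (G₁ ^ (k + α) * Fs / F₁) ≤ 1 := by
    rw [inv_mul_le_iff₀ hS0, mul_one, hS]
    exact le_add_of_nonneg_right (by positivity)
  obtain ⟨K', hf'⟩ := hf.exists_const_smul_comp_const_smul a c
  obtain ⟨L', hg'⟩ := hg.exists_const_smul_comp_const_smul c⁻¹ μ
  have key := hC hf' hg' ?_ ?_ ?_ ?_ (μ⁻¹ • x) (μ⁻¹ • y)
  · have ecomp : ((fun z => a • f (c • z)) ∘ fun z => c⁻¹ • g (μ • z)) =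
        fun z => a • (f ∘ g) (μ • z) := by
      funext z
      simp [smul_smul, mul_inv_cancel₀ hc0.ne']
    have hcd : ContDiff ℝ ((k + 1 : ℕ) : WithTop ℕ∞) (f ∘ g) := hf.contDiff.comp hg.contDiff
    rw [ecomp, iteratedFDeriv_const_smul_comp_const_smul hcd,
      iteratedFDeriv_const_smul_comp_const_smul hcd, ← smul_sub, norm_smul,
      Real.norm_of_nonneg (by positivity), smul_inv_smul₀ hμ0.ne', smul_inv_smul₀ hμ0.ne',
      hscale μ⁻¹ x y (by positivity), Real.inv_rpow hμ0.le] at key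
    have hμα : 0 < μ ^ α := by positivity
    have h1 : a * μ ^ (k + 1) * μ ^ α *
        ‖iteratedFDeriv ℝ (k + 1) (f ∘ g) x - iteratedFDeriv ℝ (k + 1) (f ∘ g) y‖ ≤
          C * ‖x - y‖ ^ α := by
      have h2 := mul_le_mul_of_nonneg_left key hμα.le
      have h3 : μ ^ α * (C * ((μ ^ α)⁻¹ * ‖x - y‖ ^ α)) = C * ‖x - y‖ ^ α := by
        field_simp
      linarith
    have h4 : a * μ ^ (k + 1) * μ ^ α = (G₁ * F₁ * S)⁻¹ := by
      rw [mul_assoc, hpow μ hμ0, hμS, ha, hc]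
      field_simp
    have h5 : G₁ * F₁ * S = Fs * G₁ ^ (k + 1 + α) + F₁ * Gs := by
      have h6 : G₁ ^ (k + 1 + α) = G₁ * G₁ ^ (k + α) := by
        rw [← hpow G₁ hG1, ← Real.rpow_natCast, ← Real.rpow_add hG1]
        push_cast
        rfl
      rw [h6, hS]
      field_simp
    rw [h4, inv_mul_le_iff₀ (by positivity), h5] at h1
    linarith
  · intro z
    rw [fderiv_const_smul_comp_const_smul, norm_smul, Real.norm_of_nonneg (by positivity)]
    have h2 := mul_le_mul_of_nonneg_left (f1 (c • z)) (mul_pos ha0 hc0).le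
    have h3 : a * c * F₁ = 1 := by rw [ha]; field_simp
    linarith
  · intro z
    rw [fderiv_const_smul_comp_const_smul, norm_smul, Real.norm_of_nonneg (by positivity)]
    have h2 := mul_le_mul_of_nonneg_left (g1 (μ • z)) (mul_pos (inv_pos.2 hc0) hμ0).le
    have h3 : c⁻¹ * μ * G₁ = 1 := by rw [hc]; field_simp
    linarith
  · intro z w
    rw [iteratedFDeriv_const_smul_comp_const_smul hf.contDiff,
      iteratedFDeriv_const_smul_comp_const_smul hf.contDiff, ← smul_sub, norm_smul,
      Real.norm_of_nonneg (by positivity)]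
    refine (mul_le_mul_of_nonneg_left (fh (c • z) (c • w)) (by positivity)).trans ?_
    rw [hscale c z w hc0]
    have h2 : a * c ^ (k + 1) * (Fs * (c ^ α * ‖z - w‖ ^ α)) =
        (S⁻¹ * (G₁ ^ (k + α) * Fs / F₁)) * ‖z - w‖ ^ α := by
      have : a * c ^ (k + 1) * (Fs * (c ^ α * ‖z - w‖ ^ α)) =
        a * (c ^ (k + 1) * c ^ α) * Fs * ‖z - w‖ ^ α := by ring
      rw [this, hpow c hc0, ← hμS, hc, Real.mul_rpow hμ0.le hG1.le, ha, hc]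
      field_simp
    rw [h2]
    exact mul_le_of_le_one_left (by positivity) hSf
  · intro z w
    rw [iteratedFDeriv_const_smul_comp_const_smul hg.contDiff,
      iteratedFDeriv_const_smul_comp_const_smul hg.contDiff, ← smul_sub, norm_smul,
      Real.norm_of_nonneg (by positivity)]
    refine (mul_le_mul_of_nonneg_left (gh (μ • z) (μ • w)) (by positivity)).trans ?_
    rw [hscale μ z w hμ0]
    have h2 : c⁻¹ * μ ^ (k + 1) * (Gs * (μ ^ α * ‖z - w‖ ^ α)) =
        (S⁻¹ * (Gs / G₁)) * ‖z - w‖ ^ α := by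
      have : c⁻¹ * μ ^ (k + 1) * (Gs * (μ ^ α * ‖z - w‖ ^ α)) =
        c⁻¹ * (μ ^ (k + 1) * μ ^ α) * Gs * ‖z - w‖ ^ α := by ring
      rw [this, hpow μ hμ0, ← hμS, hc]
      field_simp
    rw [h2]
    exact mul_le_of_le_one_left (by positivity) hSg

/-- The composition estimate in Hölder spaces of order `k + 1 + α`. -/
theorem exists_holderBall_comp {α : ℝ} (hα : 0 < α) (hα1 : α ≤ 1) (k : ℕ) :
    ∃ C : ℝ, 1 ≤ C ∧ ∀ {f : W → F} {g : V → W} {F₀ F₁ Fs G₁ Gs : ℝ},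
      HolderBall (k + 1) α Fs f → HolderBall (k + 1) α Gs g →
      (∀ x, ‖f x‖ ≤ F₀) → (∀ x, ‖fderiv ℝ f x‖ ≤ F₁) → (∀ x, ‖fderiv ℝ g x‖ ≤ G₁) →
      HolderBall (k + 1) α (C * (Fs * G₁ ^ (k + 1 + α) + F₁ * Gs + F₀)) (f ∘ g) := by
  obtain ⟨A, hA1, hA⟩ := exists_holderBall_of_norm_le_of_holder (V := V) hα (k + 1)
  obtain ⟨C, hC1, hC⟩ := exists_holder_comp_of_pos (V := V) (W := W) (F := F) hα hα1 k
  refine ⟨A * C, one_le_mul_of_one_le_of_one_le hA1 hC1,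
    fun {f g F₀ F₁ Fs G₁ Gs} hf hg f0 f1 g1 => ?_⟩
  have hF0 : 0 ≤ F₀ := (norm_nonneg _).trans (f0 0)
  have hF1 : 0 ≤ F₁ := (norm_nonneg _).trans (f1 0)
  have hG1 : 0 ≤ G₁ := (norm_nonneg _).trans (g1 0)
  have hFs := hf.nonneg
  have hGs := hg.nonneg
  obtain ⟨K, hK⟩ := hf.exists_comp hα hα1 hg
  have hlim : ∀ x y,
      ‖iteratedFDeriv ℝ (k + 1) (f ∘ g) x - iteratedFDeriv ℝ (k + 1) (f ∘ g) y‖ ≤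
        C * (Fs * G₁ ^ (k + 1 + α) + F₁ * Gs) * ‖x - y‖ ^ α := by
    intro x y
    have hcont : Continuous fun ε : ℝ => C * ((Fs + ε) * (G₁ + ε) ^ (k + 1 + α) +
        (F₁ + ε) * (Gs + ε)) * ‖x - y‖ ^ α := by
      have : Continuous fun ε : ℝ => (G₁ + ε) ^ (k + 1 + α) :=
        (continuous_const.add continuous_id).rpow_const fun _ => Or.inr (by positivity)
      fun_prop
    have ht := (hcont.tendsto 0).mono_left (nhdsWithin_le_nhds (s := Set.Ioi 0))
    simp only [add_zero] at ht
    refine ge_of_tendsto ht (Filter.eventually_of_mem self_mem_nhdsWithin fun ε hε => ?_)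
    have hε0 : (0 : ℝ) < ε := hε
    exact hC hf hg (by linarith) (by linarith) (by linarith) (by linarith)
      (fun z => (f1 z).trans (by linarith)) (fun z => (g1 z).trans (by linarith))
      (fun z w => (hf.holder z w).trans (by gcongr; linarith))
      (fun z w => (hg.holder z w).trans (by gcongr; linarith)) x y
  rw [mul_assoc]
  have hT : 0 ≤ Fs * G₁ ^ (k + 1 + α) + F₁ * Gs := by positivity
  refine hA hK (fun x => (f0 (g x)).trans ?_) fun x y => (hlim x y).trans ?_
  · nlinarith
  · exact mul_le_mul_of_nonneg_right (mul_le_mul_of_nonneg_left (by linarith) (by linarith))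
      (by positivity)

/-- The composition estimate in Hölder spaces of order `m + α ≥ 1`. -/
theorem exists_holderBall_comp_of_one_le {α : ℝ} (hα : 0 < α) (hα1 : α ≤ 1) (m : ℕ)
    (hm : 1 ≤ m + α) :
    ∃ C : ℝ, 1 ≤ C ∧ ∀ {f : W → F} {g : V → W} {F₀ F₁ Fs G₁ Gs : ℝ},
      Differentiable ℝ f → Differentiable ℝ g → HolderBall m α Fs f → HolderBall m α Gs g →
      (∀ x, ‖f x‖ ≤ F₀) → (∀ x, ‖fderiv ℝ f x‖ ≤ F₁) → (∀ x, ‖fderiv ℝ g x‖ ≤ G₁) →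
      HolderBall m α (C * (Fs * G₁ ^ (m + α) + F₁ * Gs + F₀)) (f ∘ g) := by
  cases m with
  | succ k =>
    obtain ⟨C, hC1, hC⟩ := exists_holderBall_comp (V := V) (W := W) (F := F) hα hα1 k
    refine ⟨C, hC1, fun {f g F₀ F₁ Fs G₁ Gs} _ _ hf hg f0 f1 g1 => ?_⟩
    push_cast
    exact hC hf hg f0 f1 g1
  | zero =>
    obtain rfl : α = 1 := le_antisymm hα1 (by simpa using hm)
    refine ⟨1, le_rfl, fun {f g F₀ F₁ Fs G₁ Gs} df dg hf hg f0 f1 g1 => ?_⟩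
    have hF0 : 0 ≤ F₀ := (norm_nonneg _).trans (f0 0)
    have hF1 : 0 ≤ F₁ := (norm_nonneg _).trans (f1 0)
    have hG1 : 0 ≤ G₁ := (norm_nonneg _).trans (g1 0)
    have hFs := hf.nonneg
    have hGs := hg.nonneg
    obtain ⟨-, -, g2⟩ := HolderBall.zero_iff.1 hg
    have h1 : 0 ≤ Fs * G₁ ^ (((0 : ℕ) : ℝ) + 1) := by positivity
    have h2 : 0 ≤ F₁ * Gs := by positivity
    rw [one_mul]
    refine HolderBall.zero_iff.2 ⟨(df.comp dg).continuous,
      fun x => (f0 (g x)).trans (by linarith), fun x y => ?_⟩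
    have hf' : ‖f (g x) - f (g y)‖ ≤ F₁ * ‖g x - g y‖ :=
      convex_univ.norm_image_sub_le_of_norm_fderiv_le (fun z _ => df z)
        (fun z _ => f1 z) (Set.mem_univ _) (Set.mem_univ _)
    refine hf'.trans ((mul_le_mul_of_nonneg_left (g2 x y) hF1).trans ?_)
    rw [← mul_assoc]
    exact mul_le_mul_of_nonneg_right (by linarith) (by positivity)

end CompositionEstimate

end Bias

namespace Bias

section HolderNorm

variable {n : ℕ} {F : Type} [NormedAddCommGroup F] [NormedSpace ℝ F] {u : E n → F}

theorem enorm_iteratedFDeriv_le_cNorm {j k : ℕ} (hj : j ≤ k) (u : E n → F) (x : E n) :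
    ‖iteratedFDeriv ℝ j u x‖ₑ ≤ cNorm k u :=
  (le_iSup (fun x : E n => ‖iteratedFDeriv ℝ j u x‖ₑ) x).trans
    (le_iSup (fun i : Fin (k + 1) => ⨆ x : E n, ‖iteratedFDeriv ℝ (i : ℕ) u x‖ₑ)
      ⟨j, Nat.lt_succ_of_le hj⟩)

theorem cNorm_le_ofReal {k : ℕ} {M : ℝ} (h : ∀ j ≤ k, ∀ x, ‖iteratedFDeriv ℝ j u x‖ ≤ M) :
    cNorm k u ≤ ENNReal.ofReal M :=
  iSup_le fun i => iSup_le fun x => by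
    rw [← ofReal_norm]
    exact ENNReal.ofReal_le_ofReal (h i (Nat.lt_succ_iff.1 i.2) x)

theorem cNorm_mono {j k : ℕ} (hjk : j ≤ k) (u : E n → F) : cNorm j u ≤ cNorm k u :=
  iSup_le fun i => iSup_le fun x =>
    enorm_iteratedFDeriv_le_cNorm ((Nat.lt_succ_iff.1 i.2).trans hjk) u x

theorem cNorm_le_holderNorm (σ : ℝ) (u : E n → F) : cNorm ⌊σ⌋₊ u ≤ holderNorm σ u :=
  le_self_add

theorem holderNorm_natCast (k : ℕ) (u : E n → F) : holderNorm k u = cNorm k u := by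
  simp [holderNorm]

theorem holderNorm_zero (u : E n → F) : holderNorm 0 u = cNorm 0 u := by
  simpa using holderNorm_natCast 0 u

theorem holderNorm_one (u : E n → F) : holderNorm 1 u = cNorm 1 u := by
  simpa using holderNorm_natCast 1 u

theorem holderNorm_zero_le_one (u : E n → F) : holderNorm 0 u ≤ holderNorm 1 u := by
  rw [holderNorm_zero, holderNorm_one]
  exact cNorm_mono zero_le_one u

theorem holderNorm_one_le {σ : ℝ} (hσ : 1 ≤ σ) (u : E n → F) :
    holderNorm 1 u ≤ holderNorm σ u := by
  rw [holderNorm_one]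
  exact (cNorm_mono (Nat.le_floor (by simpa using hσ)) u).trans (cNorm_le_holderNorm σ u)

theorem enorm_le_holderNorm_zero (u : E n → F) (x : E n) : ‖u x‖ₑ ≤ holderNorm 0 u := by
  rw [holderNorm_zero]
  refine le_trans (le_of_eq ?_) (enorm_iteratedFDeriv_le_cNorm le_rfl u x)
  rw [← ofReal_norm, ← ofReal_norm, norm_iteratedFDeriv_zero]

theorem enorm_fderiv_le_holderNorm_one (u : E n → F) (x : E n) :
    ‖fderiv ℝ u x‖ₑ ≤ holderNorm 1 u := by
  rw [holderNorm_one]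
  refine le_trans (le_of_eq ?_) (enorm_iteratedFDeriv_le_cNorm le_rfl u x)
  rw [← ofReal_norm, ← ofReal_norm, norm_iteratedFDeriv_one]

theorem norm_le_toReal_of_enorm_le {G : Type*} [SeminormedAddCommGroup G] {z : G} {a : ℝ≥0∞}
    (ha : a < ⊤) (h : ‖z‖ₑ ≤ a) : ‖z‖ ≤ a.toReal := by
  rw [← toReal_enorm]
  exact ENNReal.toReal_mono ha.ne h

theorem floor_natCast_add_of_lt_one (m : ℕ) {α : ℝ} (hα : 0 < α) (hα1 : α < 1) :
    ⌊(m : ℝ) + α⌋₊ = m :=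
  (Nat.floor_eq_iff (by positivity)).2 ⟨by linarith, by linarith⟩

theorem floor_natCast_add_one (m : ℕ) : ⌊(m : ℝ) + 1⌋₊ = m + 1 := by
  exact_mod_cast Nat.floor_natCast (R := ℝ) (m + 1)

theorem exists_eq_natCast_add {σ : ℝ} (hσ : 1 ≤ σ) :
    ∃ (m : ℕ) (α : ℝ), 0 < α ∧ α ≤ 1 ∧ σ = m + α := by
  have h1 : 1 ≤ ⌈σ⌉₊ := Nat.one_le_ceil_iff.2 (by linarith)
  have h2 := Nat.ceil_lt_add_one (show 0 ≤ σ by linarith)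
  have h3 := Nat.le_ceil σ
  refine ⟨⌈σ⌉₊ - 1, σ - ((⌈σ⌉₊ - 1 : ℕ) : ℝ), ?_, ?_, by ring⟩
  all_goals push_cast [Nat.cast_sub h1]; linarith

theorem IsHolder.norm_iteratedFDeriv_le {σ : ℝ} (h : IsHolder σ u) {j : ℕ} (hj : j ≤ ⌊σ⌋₊)
    (x : E n) : ‖iteratedFDeriv ℝ j u x‖ ≤ (holderNorm σ u).toReal :=
  norm_le_toReal_of_enorm_le h.2
    ((enorm_iteratedFDeriv_le_cNorm hj u x).trans (cNorm_le_holderNorm σ u))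

theorem IsHolder.holderBall {m : ℕ} {α : ℝ} (hα : 0 < α) (hα1 : α ≤ 1)
    (h : IsHolder (m + α) u) : HolderBall m α (holderNorm (m + α) u).toReal u := by
  rcases hα1.lt_or_eq with hlt | rfl
  · have hfl := floor_natCast_add_of_lt_one m hα hlt
    refine ⟨by simpa only [hfl] using h.1, fun j hj x => h.norm_iteratedFDeriv_le (by omega) x,
      fun x y => ?_⟩
    rcases eq_or_ne x y with rfl | hxy
    · simp [hα.ne']
    · have hpos : 0 < ‖x - y‖ ^ α := Real.rpow_pos_of_pos (norm_sub_pos_iff.2 hxy) α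
      rw [← div_le_iff₀ hpos, ← ENNReal.ofReal_le_iff_le_toReal h.2.ne]
      have hne : ¬ ((m : ℝ) = m + α) := by linarith
      unfold holderNorm
      rw [hfl, if_neg hne, add_sub_cancel_left]
      refine le_trans ?_ le_add_self
      exact le_iSup_of_le x (le_iSup_of_le y (le_iSup_of_le hxy le_rfl))
  · have hfl := floor_natCast_add_one m
    have hcd : ContDiff ℝ ((m + 1 : ℕ) : WithTop ℕ∞) u := by simpa only [hfl] using h.1
    refine ⟨hcd.of_le (by exact_mod_cast Nat.le_succ m),
      fun j hj x => h.norm_iteratedFDeriv_le (by omega) x, fun x y => ?_⟩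
    rw [Real.rpow_one]
    refine convex_univ.norm_image_sub_le_of_norm_fderiv_le (𝕜 := ℝ)
      (fun z _ => hcd.differentiable_iteratedFDeriv (by exact_mod_cast Nat.lt_succ_self m) z)
      (fun z _ => ?_) (Set.mem_univ y) (Set.mem_univ x)
    rw [norm_fderiv_iteratedFDeriv]
    exact h.norm_iteratedFDeriv_le (by omega) z

theorem HolderBall.holderNorm_le {m : ℕ} {α M : ℝ} (hα : 0 < α) (hα1 : α ≤ 1)
    (h : HolderBall m α M u) : holderNorm (m + α) u ≤ ENNReal.ofReal (2 * M) := by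
  have hM := h.nonneg
  rcases hα1.lt_or_eq with hlt | rfl
  · have hfl := floor_natCast_add_of_lt_one m hα hlt
    have hne : ¬ ((m : ℝ) = m + α) := by linarith
    unfold holderNorm
    rw [hfl, if_neg hne, add_sub_cancel_left, two_mul, ENNReal.ofReal_add hM hM]
    refine add_le_add (cNorm_le_ofReal h.bound) (iSup_le fun x => iSup_le fun y => iSup_le
      fun hxy => ENNReal.ofReal_le_ofReal ?_)
    rw [div_le_iff₀ (Real.rpow_pos_of_pos (norm_sub_pos_iff.2 hxy) α)]
    exact h.holder x y
  · rw [show ((m : ℝ) + 1) = ((m + 1 : ℕ) : ℝ) by push_cast; rfl, holderNorm_natCast]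
    refine cNorm_le_ofReal fun j hj x => ?_
    rcases Nat.lt_succ_iff_lt_or_eq.1 (Nat.lt_succ_of_le hj) with hj | rfl
    · exact (h.bound j (Nat.lt_succ_iff.1 hj) x).trans (by linarith)
    · rw [← norm_fderiv_iteratedFDeriv]
      refine (norm_fderiv_le_of_lip' ℝ hM (Filter.Eventually.of_forall fun y => ?_)).trans
        (by linarith)
      simpa using h.holder y x

/-- The composition estimate for the Hölder norms. -/
theorem exists_holderNorm_comp_le (n : ℕ) {σ : ℝ} (hσ : 1 ≤ σ) : ∃ C : ℝ, 1 ≤ C ∧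
    ∀ (f : E n → ℝ) (g : E n → E n), IsHolder σ f → IsHolder σ g →
      IsHolder σ (f ∘ g) ∧ holderNorm σ (f ∘ g) ≤ ENNReal.ofReal C *
        (holderNorm σ f * holderNorm 1 g ^ σ + holderNorm 1 f * holderNorm σ g +
          holderNorm 0 f) := by
  obtain ⟨m, α, hα, hα1, rfl⟩ := exists_eq_natCast_add hσ
  obtain ⟨C, hC1, hC⟩ := exists_holderBall_comp_of_one_le (V := E n) (W := E n) (F := ℝ) hα hα1 m hσ
  refine ⟨2 * C, by linarith, fun f g hf hg => ?_⟩
  have hfl : 1 ≤ ⌊(m : ℝ) + α⌋₊ := Nat.le_floor (by simpa using hσ)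
  have f1 : holderNorm 1 f < ⊤ := (holderNorm_one_le hσ f).trans_lt hf.2
  have g1 : holderNorm 1 g < ⊤ := (holderNorm_one_le hσ g).trans_lt hg.2
  have f0 : holderNorm 0 f < ⊤ := (holderNorm_zero_le_one f).trans_lt f1
  have hne : ((⌊(m : ℝ) + α⌋₊ : ℕ) : WithTop ℕ∞) ≠ 0 := by
    exact_mod_cast (Nat.one_le_iff_ne_zero.1 hfl)
  have key := (hC (hf.1.differentiable hne) (hg.1.differentiable hne) (hf.holderBall hα hα1)
    (hg.holderBall hα hα1)
    (fun x => norm_le_toReal_of_enorm_le f0 (enorm_le_holderNorm_zero f x))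
    (fun x => norm_le_toReal_of_enorm_le f1 (enorm_fderiv_le_holderNorm_one f x))
    (fun x => norm_le_toReal_of_enorm_le g1 (enorm_fderiv_le_holderNorm_one g x))).holderNorm_le
      hα hα1
  refine ⟨⟨hf.1.comp hg.1, key.trans_lt ENNReal.ofReal_lt_top⟩, key.trans (le_of_eq ?_)⟩
  have hσ0 : 0 ≤ (m : ℝ) + α := by linarith
  rw [← mul_assoc, ENNReal.ofReal_mul (p := 2 * C) (by linarith),
    ENNReal.ofReal_add (by positivity) (by positivity),
    ENNReal.ofReal_add (by positivity) (by positivity),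
    ENNReal.ofReal_mul (p := (holderNorm _ f).toReal) (by positivity),
    ENNReal.ofReal_mul (p := (holderNorm 1 f).toReal) (by positivity), ENNReal.toReal_rpow,
    ENNReal.ofReal_toReal hf.2.ne, ENNReal.ofReal_toReal hg.2.ne, ENNReal.ofReal_toReal f1.ne,
    ENNReal.ofReal_toReal f0.ne, ENNReal.ofReal_toReal (ENNReal.rpow_ne_top_of_nonneg hσ0 g1.ne)]

end HolderNorm

end Bias

namespace Bias

/-- Chain rule for `p ↦ φ (γ p) p`, with only the second partial derivative of `φ` continuous. -/
theorem hasFDerivAt_comp_diagonal {P W F : Type*} [NormedAddCommGroup P] [NormedSpace ℝ P]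
    [NormedAddCommGroup W] [NormedSpace ℝ W] [NormedAddCommGroup F] [NormedSpace ℝ F]
    {φ : W → P → F} {γ : P → W} {p : P} {φ₁ : W →L[ℝ] F} {γ' : P →L[ℝ] W}
    {φ₂ : W → P → P →L[ℝ] F} {A : Set P} (hA : A ∈ 𝓝 p)
    (h₁ : HasFDerivAt (fun y => φ y p) φ₁ (γ p)) (hγ : HasFDerivAt γ γ' p)
    (h₂ : ∀ y, ∀ z ∈ A, HasFDerivAt (φ y) (φ₂ y z) z)
    (hc : ContinuousAt (fun x : W × P => φ₂ x.1 x.2) (γ p, p)) :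
    HasFDerivAt (fun z => φ (γ z) z) (φ₁.comp γ' + φ₂ (γ p) p) p := by
  have hψ : HasFDerivAt (fun z => φ (γ z) z - φ (γ z) p) (φ₂ (γ p) p) p := by
    rw [hasFDerivAt_iff_isLittleO, Asymptotics.isLittleO_iff]
    intro ε hε
    have h3 : ∀ᶠ x : W × P in 𝓝 (γ p) ×ˢ 𝓝 p, dist (φ₂ x.1 x.2) (φ₂ (γ p) p) < ε := by
      rw [← nhds_prod_eq]
      exact Metric.tendsto_nhds.1 hc ε hε
    obtain ⟨P₁, hP₁, P₂, hP₂, h4⟩ := Filter.eventually_prod_iff.1 h3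
    obtain ⟨δ, hδ, hball⟩ := Metric.eventually_nhds_iff_ball.1 (hP₂.and hA)
    filter_upwards [hγ.continuousAt.eventually hP₁, Metric.ball_mem_nhds p hδ] with z hz hzδ
    have := (convex_ball p δ).norm_image_sub_le_of_norm_hasFDerivWithin_le' (𝕜 := ℝ)
      (f := φ (γ z)) (f' := φ₂ (γ z)) (φ := φ₂ (γ p) p) (C := ε) (x := p) (y := z)
      (fun y hy => (h₂ (γ z) y (hball y hy).2).hasFDerivWithinAt)
      (fun y hy => by rw [← dist_eq_norm]; exact (h4 hz (hball y hy).1).le)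
      (Metric.mem_ball_self hδ) hzδ
    simpa using this
  have h := (h₁.comp p hγ).add hψ
  refine h.congr_of_eventuallyEq (Filter.Eventually.of_forall fun z => ?_)
  simp

section

variable {n : ℕ} {A : Set (E n)} {σ : ℝ}

theorem IsHolder.differentiable {F : Type} [NormedAddCommGroup F] [NormedSpace ℝ F] {u : E n → F}
    (hσ : 1 ≤ σ) (h : IsHolder σ u) : Differentiable ℝ u := by
  have hfl : 1 ≤ ⌊σ⌋₊ := Nat.le_floor (by simpa using hσ)
  exact h.1.differentiable (by exact_mod_cast (Nat.one_le_iff_ne_zero.1 hfl))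

theorem hasFDerivAt_compB {F : Type} [NormedAddCommGroup F] [NormedSpace ℝ F]
    {f : E n → E n → ℝ → F} {g : E n → E n → ℝ → E n} (hA : IsOpen A)
    (hσ : 1 ≤ σ) (hf : MemB σ A f) (hg : MemB σ A g) (q : E n) {p : E n} (hp : p ∈ A) (t : ℝ) :
    HasFDerivAt (fun p' => compB f g q p' t)
      ((qderiv f (g q p t) p t).comp (pderiv g q p t) + pderiv f (g q p t) p t) p := by
  refine hasFDerivAt_comp_diagonal (φ := fun y p' => f y p' t) (γ := fun p' => g q p' t)
    (φ₂ := fun y p' => pderiv f y p' t) (hA.mem_nhds hp)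
    ((hf.holder p hp t).differentiable hσ _).hasFDerivAt (hg.diff q p hp t).hasFDerivAt
    (fun y z hz => (hf.diff y z hz t).hasFDerivAt) ?_
  have hopen : IsOpen (Set.univ ×ˢ (A ×ˢ (Set.univ : Set ℝ)) : Set (E n × E n × ℝ)) :=
    isOpen_univ.prod (hA.prod isOpen_univ)
  have h := hf.cont_pderiv.continuousAt (x := (g q p t, p, t)) (hopen.mem_nhds (by simp [hp]))
  exact ContinuousAt.comp (f := fun x : E n × E n => (x.1, x.2, t)) (x := (g q p t, p)) h
    (by fun_prop)

theorem JointCont.compB {F : Type*} [TopologicalSpace F] {f : E n → E n → ℝ → F}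
    {g : E n → E n → ℝ → E n} (hf : JointCont A f) (hg : JointCont A g) :
    JointCont A (fun q p t => f (g q p t) p t) := by
  have hm : ContinuousOn (fun x : E n × E n × ℝ => (g x.1 x.2.1 x.2.2, x.2.1, x.2.2))
      (Set.univ ×ˢ (A ×ˢ (Set.univ : Set ℝ))) :=
    hg.prodMk continuousOn_snd
  exact ContinuousOn.comp (t := Set.univ ×ˢ (A ×ˢ (Set.univ : Set ℝ))) hf hm
    fun x hx => ⟨Set.mem_univ _, hx.2⟩

theorem HolderBall.zero_of {V : Type} [NormedAddCommGroup V] [NormedSpace ℝ V] {F : Type}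
    [NormedAddCommGroup F] [NormedSpace ℝ F] {u : V → F} {α : ℝ} (hα : 0 < α) (hα1 : α ≤ 1)
    {k : ℕ} : ∀ {M : ℝ}, HolderBall k α M u → HolderBall 0 α (2 ^ k * M) u := by
  induction k with
  | zero => intro M h; simpa using h
  | succ k ih => intro M h; exact (ih (h.of_succ hα hα1)).congr_bound (by ring)

theorem one_le_w1 (l t : ℝ) : 1 ≤ w1 l t := by
  unfold w1
  split_ifs
  · exact le_rfl
  · have : 0 ≤ |t| ^ l := by positivity
    linarith

theorem one_le_w2 (l t : ℝ) : 1 ≤ w2 l t := by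
  unfold w2
  split_ifs
  · exact le_rfl
  · have : 0 ≤ |t| ^ (l - 1) := by positivity
    linarith

section Norms

variable {F : Type} [NormedAddCommGroup F] [NormedSpace ℝ F] {f : E n → E n → ℝ → F} {l : ℝ}

theorem holderNorm_mul_le_wnormB (σ l : ℝ) (f : E n → E n → ℝ → F) {p : E n} (hp : p ∈ A)
    (t : ℝ) :
    holderNorm σ (fun q => f q p t) * ENNReal.ofReal (w1 l t) ≤ wnormB σ l A f :=
  (le_iSup₂_of_le (f := fun p (_ : p ∈ A) => ⨆ t : ℝ, holderNorm σ (fun q => f q p t) *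
    ENNReal.ofReal (w1 l t)) p hp (le_iSup_of_le t le_rfl)).trans le_self_add

theorem enorm_pderiv_mul_le_wnormB (σ l : ℝ) (f : E n → E n → ℝ → F) (q : E n) {p : E n}
    (hp : p ∈ A) (t : ℝ) :
    ‖pderiv f q p t‖ₑ * ENNReal.ofReal (w2 l t) ≤ wnormB σ l A f :=
  (le_iSup₂_of_le (f := fun p (_ : p ∈ A) => ⨆ t : ℝ, (⨆ q : E n, ‖pderiv f q p t‖ₑ) *
    ENNReal.ofReal (w2 l t)) p hp (le_iSup_of_le t
      (mul_le_mul_left (le_iSup (fun q => ‖pderiv f q p t‖ₑ) q) _))).trans le_add_self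

theorem holderNorm_le_wnormB (σ l : ℝ) (f : E n → E n → ℝ → F) {p : E n} (hp : p ∈ A)
    (t : ℝ) : holderNorm σ (fun q => f q p t) ≤ wnormB σ l A f := by
  refine le_trans ?_ (holderNorm_mul_le_wnormB σ l f hp t)
  refine le_mul_of_one_le_right (by simp) ?_
  rw [← ENNReal.ofReal_one]
  exact ENNReal.ofReal_le_ofReal (one_le_w1 l t)

/-- A uniform `C^σ` bound with `σ > 1` makes `∂_q f` jointly continuous. -/
theorem jointCont_qderiv_of_wnormB_lt_top (hσ : 1 < σ) (hf : MemB σ A f)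
    (hfin : wnormB σ l A f < ⊤) : JointCont A (qderiv f) := by
  obtain ⟨m, α, hα, hα1, rfl⟩ := exists_eq_natCast_add hσ.le
  obtain ⟨k, rfl⟩ : ∃ k, m = k + 1 := by
    refine Nat.exists_eq_succ_of_ne_zero ?_
    rintro rfl
    simp only [Nat.cast_zero, zero_add] at hσ
    linarith
  set H : ℝ := 2 ^ k * (wnormB (((k + 1 : ℕ) : ℝ) + α) l A f).toReal with hH
  have hH0 : 0 ≤ H := by positivity
  have taylor : ∀ p ∈ A, ∀ (t : ℝ) (q w : E n),
      ‖f (q + w) p t - f q p t - qderiv f q p t w‖ ≤ H * ‖w‖ ^ α * ‖w‖ := by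
    intro p hp t q w
    have hb := ((hf.holder p hp t).holderBall hα hα1).mono
      (ENNReal.toReal_mono hfin.ne (holderNorm_le_wnormB _ l f hp t))
    obtain ⟨h0, -, h2⟩ := HolderBall.succ_iff.1 hb
    obtain ⟨-, -, h3⟩ := HolderBall.zero_iff.1 (h2.zero_of hα hα1)
    exact norm_sub_sub_fderiv_le (u := fun q => f q p t) h0 hα.le hH0 h3 q w
  unfold JointCont
  rw [continuousOn_clm_apply]
  intro v
  have hlim : TendstoUniformlyOn
      (fun (h : ℝ) (x : E n × E n × ℝ) =>
        h⁻¹ • (f (x.1 + h • v) x.2.1 x.2.2 - f x.1 x.2.1 x.2.2))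
      (fun x => qderiv f x.1 x.2.1 x.2.2 v) (𝓝[>] 0)
      (Set.univ ×ˢ (A ×ˢ (Set.univ : Set ℝ))) := by
    rw [Metric.tendstoUniformlyOn_iff]
    intro ε hε
    have hc : Continuous fun h : ℝ => H * ‖h • v‖ ^ α * ‖v‖ := by
      have : Continuous fun h : ℝ => ‖h • v‖ ^ α :=
        (continuous_id.smul continuous_const).norm.rpow_const fun _ => Or.inr hα.le
      fun_prop
    have ht := (hc.tendsto 0).mono_left (nhdsWithin_le_nhds (s := Set.Ioi 0))
    simp only [zero_smul, norm_zero, Real.zero_rpow hα.ne', mul_zero, zero_mul] at ht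
    filter_upwards [ht.eventually (gt_mem_nhds hε), self_mem_nhdsWithin] with h hh hpos x hx
    have hpos : 0 < h := hpos
    refine lt_of_le_of_lt ?_ hh
    have h1 := taylor x.2.1 hx.2.1 x.2.2 x.1 (h • v)
    rw [dist_comm, dist_eq_norm]
    have e : h⁻¹ • (f (x.1 + h • v) x.2.1 x.2.2 - f x.1 x.2.1 x.2.2) -
        qderiv f x.1 x.2.1 x.2.2 v = h⁻¹ • (f (x.1 + h • v) x.2.1 x.2.2 - f x.1 x.2.1 x.2.2 -
          qderiv f x.1 x.2.1 x.2.2 (h • v)) := by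
      rw [map_smul, smul_sub _ _ (h • _), inv_smul_smul₀ hpos.ne']
    rw [e, norm_smul, norm_inv, Real.norm_of_nonneg hpos.le, inv_mul_le_iff₀ hpos]
    refine h1.trans (le_of_eq ?_)
    nth_rw 2 [norm_smul]
    rw [Real.norm_of_nonneg hpos.le]
    ring
  refine hlim.continuousOn (Filter.Frequently.of_forall fun h => ?_)
  have h2 : JointCont A fun q p t => f (q + h • v) p t :=
    JointCont.compB (g := fun q _ _ => q + h • v) hf.cont (by unfold JointCont; fun_prop)
  exact (h2.sub hf.cont).const_smul h⁻¹

end Norms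

theorem w1_add_le {l m : ℝ} (hl : l = 0 ∨ 1 ≤ l) (hm : m = 0 ∨ 1 ≤ m) (t : ℝ) :
    w1 (l + m) t ≤ w1 l t * w1 m t := by
  rcases hl with rfl | hl
  · simp [w1]
  rcases hm with rfl | hm
  · simp [w1]
  · have h1 : l ≠ 0 := by linarith
    have h2 : m ≠ 0 := by linarith
    have h3 : l + m ≠ 0 := by linarith
    simp only [w1, if_neg h1, if_neg h2, if_neg h3]
    rw [Real.rpow_add_of_nonneg (abs_nonneg t) (by linarith) (by linarith)]
    have : 0 ≤ |t| ^ l := by positivity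
    have : 0 ≤ |t| ^ m := by positivity
    nlinarith

theorem w2_add_le {l m : ℝ} (hl : l = 0 ∨ 1 ≤ l) (hm : m = 0 ∨ 1 ≤ m) (t : ℝ) :
    w2 (l + m) t ≤ 2 * (w1 l t * w2 m t) := by
  rcases hl with rfl | hl
  · have := one_le_w2 m t
    simp only [zero_add, w1, if_true, one_mul]
    linarith
  have h1 : l ≠ 0 := by linarith
  have hl0 : 0 ≤ |t| ^ l := by positivity
  rcases hm with rfl | hm
  · simp only [add_zero, w2, w1, if_neg h1, if_true, mul_one]
    rcases le_total |t| 1 with ht | ht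
    · have := Real.rpow_le_one (abs_nonneg t) ht (show 0 ≤ l - 1 by linarith)
      linarith
    · have := Real.rpow_le_rpow_of_exponent_le ht (show l - 1 ≤ l by linarith)
      linarith
  · have h2 : m ≠ 0 := by linarith
    have h3 : l + m ≠ 0 := by linarith
    simp only [w2, w1, if_neg h1, if_neg h2, if_neg h3]
    rw [add_sub_assoc, Real.rpow_add_of_nonneg (abs_nonneg t) (by linarith) (by linarith)]
    have : 0 ≤ |t| ^ (m - 1) := by positivity
    nlinarith

end

end Bias

namespace Bias

section

variable {n : ℕ} {A : Set (E n)} {σ : ℝ}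

theorem jointCont_pderiv_compB {f : E n → E n → ℝ → ℝ} {g : E n → E n → ℝ → E n} (hA : IsOpen A)
    (hσ : 1 ≤ σ) (hf : MemB σ A f) (hg : MemB σ A g) (hq : JointCont A (qderiv f)) :
    JointCont A (pderiv (compB f g)) := by
  have h1 := (hq.compB hg.cont).clm_comp hg.cont_pderiv
  have h2 := hf.cont_pderiv.compB hg.cont
  refine (h1.add h2).congr fun x hx => ?_
  exact (hasFDerivAt_compB hA hσ hf hg x.1 hx.2.1 x.2.2).fderiv

theorem preB_compB {f : E n → E n → ℝ → ℝ} {g : E n → E n → ℝ → E n} (hA : IsOpen A)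
    (hσ : 1 ≤ σ) (hf : MemB σ A f) (hg : MemB σ A g) : PreB σ A (compB f g) where
  periodic q p hp t k := by simp only [compB, hg.periodic q p hp t k]
  cont := hf.cont.compB hg.cont
  diff q _ hp t := (hasFDerivAt_compB hA hσ hf hg q hp t).differentiableAt
  holder p hp t := by
    obtain ⟨C, -, hC⟩ := exists_holderNorm_comp_le n hσ
    exact (hC _ _ (hf.holder p hp t) (hg.holder p hp t)).1

theorem enorm_pderiv_compB_mul_le {f : E n → E n → ℝ → ℝ} {g : E n → E n → ℝ → E n}
    (hA : IsOpen A) (hσ : 1 ≤ σ) (hf : MemB σ A f) (hg : MemB σ A g) {l m : ℝ}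
    (hl : l = 0 ∨ 1 ≤ l) (hm : m = 0 ∨ 1 ≤ m) (q : E n) {p : E n} (hp : p ∈ A) (t : ℝ) :
    ‖pderiv (compB f g) q p t‖ₑ * ENNReal.ofReal (w2 (l + m) t) ≤
      2 * (wnormB 1 l A f * wnormB σ m A g) + wnormB 0 (l + m) A f := by
  have e : pderiv (compB f g) q p t = (qderiv f (g q p t) p t).comp (pderiv g q p t) +
      pderiv f (g q p t) p t := (hasFDerivAt_compB hA hσ hf hg q hp t).fderiv
  have hq : ‖qderiv f (g q p t) p t‖ₑ ≤ holderNorm 1 fun q => f q p t :=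
    enorm_fderiv_le_holderNorm_one (fun q => f q p t) (g q p t)
  have hcomp : ‖(qderiv f (g q p t) p t).comp (pderiv g q p t)‖ₑ ≤
      (holderNorm 1 fun q => f q p t) * ‖pderiv g q p t‖ₑ := by
    refine le_trans ?_ (mul_le_mul_left hq _)
    rw [← ofReal_norm, ← ofReal_norm, ← ofReal_norm, ← ENNReal.ofReal_mul (norm_nonneg _)]
    exact ENNReal.ofReal_le_ofReal (ContinuousLinearMap.opNorm_comp_le _ _)
  have hw : ENNReal.ofReal (w2 (l + m) t) ≤
      2 * (ENNReal.ofReal (w1 l t) * ENNReal.ofReal (w2 m t)) := by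
    have h1 : 0 ≤ w1 l t := zero_le_one.trans (one_le_w1 l t)
    rw [← ENNReal.ofReal_mul h1, ← ENNReal.ofReal_ofNat 2, ← ENNReal.ofReal_mul (by norm_num)]
    exact ENNReal.ofReal_le_ofReal (w2_add_le hl hm t)
  rw [e]
  refine (mul_le_mul_left (enorm_add_le ((qderiv f (g q p t) p t).comp (pderiv g q p t))
    (pderiv f (g q p t) p t)) _).trans ?_
  rw [add_mul]
  refine add_le_add ?_ (enorm_pderiv_mul_le_wnormB 0 (l + m) f (g q p t) hp t)
  calc _ ≤ (holderNorm 1 fun q => f q p t) * ‖pderiv g q p t‖ₑ *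
        (2 * (ENNReal.ofReal (w1 l t) * ENNReal.ofReal (w2 m t))) := mul_le_mul' hcomp hw
    _ = 2 * (((holderNorm 1 fun q => f q p t) * ENNReal.ofReal (w1 l t)) *
        (‖pderiv g q p t‖ₑ * ENNReal.ofReal (w2 m t))) := by ring
    _ ≤ _ := by
      gcongr
      · exact holderNorm_mul_le_wnormB 1 l f hp t
      · exact enorm_pderiv_mul_le_wnormB σ m g q hp t

theorem mul_w1_add_le_wnormB {f : E n → E n → ℝ → ℝ} {g : E n → E n → ℝ → E n}
    (hσ : 1 ≤ σ) {l m : ℝ} (hl : l = 0 ∨ 1 ≤ l) (hm : m = 0 ∨ 1 ≤ m)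
    {p : E n} (hp : p ∈ A) (t : ℝ) :
    ((holderNorm σ fun q => f q p t) * (holderNorm 1 fun q => g q p t) ^ σ +
      (holderNorm 1 fun q => f q p t) * (holderNorm σ fun q => g q p t) +
      holderNorm 0 fun q => f q p t) * ENNReal.ofReal (w1 (l + m) t) ≤
    wnormB σ l A f * wnormB 1 m A g ^ σ + wnormB 1 l A f * wnormB σ m A g +
      wnormB 0 (l + m) A f := by
  have hσ0 : 0 ≤ σ := by linarith
  have hw : ENNReal.ofReal (w1 (l + m) t) ≤ ENNReal.ofReal (w1 l t) * ENNReal.ofReal (w1 m t) := by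
    have h1 : 0 ≤ w1 l t := zero_le_one.trans (one_le_w1 l t)
    rw [← ENNReal.ofReal_mul h1]
    exact ENNReal.ofReal_le_ofReal (w1_add_le hl hm t)
  have hwσ : ENNReal.ofReal (w1 m t) ≤ ENNReal.ofReal (w1 m t) ^ σ := by
    refine ENNReal.le_rpow_self_of_one_le ?_ hσ
    rw [← ENNReal.ofReal_one]
    exact ENNReal.ofReal_le_ofReal (one_le_w1 m t)
  rw [add_mul, add_mul]
  refine add_le_add (add_le_add ?_ ?_) (holderNorm_mul_le_wnormB 0 (l + m) f hp t)
  · calc _ ≤ (holderNorm σ fun q => f q p t) * (holderNorm 1 fun q => g q p t) ^ σ *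
          (ENNReal.ofReal (w1 l t) * ENNReal.ofReal (w1 m t) ^ σ) := by
            gcongr
            exact hw.trans (by gcongr)
      _ = ((holderNorm σ fun q => f q p t) * ENNReal.ofReal (w1 l t)) *
          ((holderNorm 1 fun q => g q p t) * ENNReal.ofReal (w1 m t)) ^ σ := by
            rw [ENNReal.mul_rpow_of_nonneg _ _ hσ0]
            ring
      _ ≤ _ := by
        gcongr
        · exact holderNorm_mul_le_wnormB σ l f hp t
        · exact holderNorm_mul_le_wnormB 1 m g hp t
  · calc _ ≤ (holderNorm 1 fun q => f q p t) * (holderNorm σ fun q => g q p t) *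
          (ENNReal.ofReal (w1 l t) * ENNReal.ofReal (w1 m t)) := by gcongr
      _ = ((holderNorm 1 fun q => f q p t) * ENNReal.ofReal (w1 l t)) *
          ((holderNorm σ fun q => g q p t) * ENNReal.ofReal (w1 m t)) := by ring
      _ ≤ _ := by
        gcongr
        · exact holderNorm_mul_le_wnormB 1 l f hp t
        · exact holderNorm_mul_le_wnormB σ m g hp t

end

end Bias

theorem wnormB_comp (n : ℕ) (σ : ℝ) (hσ : 1 ≤ σ) :
    ∃ C : ℝ, 0 < C ∧
      ∀ (r l m : ℝ) (f : Bias.E n → Bias.E n → ℝ → ℝ) (g : Bias.E n → Bias.E n → ℝ → Bias.E n),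
        0 < r → (l = 0 ∨ 1 ≤ l) → (m = 0 ∨ 1 ≤ m) →
        Bias.MemB σ (Metric.ball 0 r) f → Bias.MemB σ (Metric.ball 0 r) g →
        Bias.PreB σ (Metric.ball 0 r) (Bias.compB f g) ∧
        (Bias.JointCont (Metric.ball 0 r) (Bias.qderiv f) ∨
            (1 < σ ∧ Bias.wnormB σ l (Metric.ball 0 r) f < ⊤) →
          Bias.MemB σ (Metric.ball 0 r) (Bias.compB f g)) ∧
        Bias.wnormB σ (l + m) (Metric.ball 0 r) (Bias.compB f g) ≤
          ENNReal.ofReal C *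
            (Bias.wnormB σ l (Metric.ball 0 r) f * Bias.wnormB 1 m (Metric.ball 0 r) g ^ σ +
              Bias.wnormB 1 l (Metric.ball 0 r) f * Bias.wnormB σ m (Metric.ball 0 r) g +
              Bias.wnormB 0 (l + m) (Metric.ball 0 r) f) := by
  obtain ⟨C, hC1, hC⟩ := Bias.exists_holderNorm_comp_le n hσ
  refine ⟨C + 2, by linarith, fun r l m f g _ hl hm hf hg => ?_⟩
  have hA : IsOpen (Metric.ball (0 : Bias.E n) r) := Metric.isOpen_ball
  have hpre := Bias.preB_compB hA hσ hf hg
  refine ⟨hpre, fun h => ⟨hpre, Bias.jointCont_pderiv_compB hA hσ hf hg ?_⟩, ?_⟩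
  · rcases h with h | ⟨h1, h2⟩
    · exact h
    · exact Bias.jointCont_qderiv_of_wnormB_lt_top h1 hf h2
  · rw [ENNReal.ofReal_add (by linarith) (by norm_num), add_mul]
    refine add_le_add (iSup₂_le fun p hp => iSup_le fun t => ?_)
      (iSup₂_le fun p hp => iSup_le fun t => ?_)
    · refine (mul_le_mul_left (hC _ _ (hf.holder p hp t) (hg.holder p hp t)).2 _).trans ?_
      rw [mul_assoc]
      exact mul_le_mul_right (Bias.mul_w1_add_le_wnormB hσ hl hm hp t) _
    · rw [ENNReal.iSup_mul]
      refine iSup_le fun q =>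
        (Bias.enorm_pderiv_compB_mul_le hA hσ hf hg hl hm q hp t).trans ?_
      rw [ENNReal.ofReal_ofNat, mul_add, mul_add]
      refine add_le_add le_add_self ?_
      rw [two_mul]
      exact le_self_add
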